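/- arXiv:1911.10733 — 2 statements merged into one kernel-verified Lean document; each statement's English description precedes it below -/
import Mathlib

section
/- Let A₁, …, Aₙ be positive invertible operators on H with mI ≤ Aⱼ ≤ MI (j = 1, …, n) for some scalars 0 < m < M, let h = M/m, and let F satisfy the arithmetic–harmonic sandwich for the probability vector ω. Then for every r ≥ 1, K(h, −r)⁻¹·K(h, r)⁻¹·F(A₁, …, Aₙ)ʳ ≤ F(A₁ʳ, …, Aₙʳ) ≤ K(h, −r)·K(h, r)·F(A₁, …, Aₙ)ʳ. In particular, if F(A₁, …, Aₙ) ≤ I then F(A₁ʳ, …, Aₙʳ) ≤ K(h, −r)·K(h, r)·I for r ≥ 1. -/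
noncomputable section

/-- The arithmetic–harmonic sandwich for the probability vector `ω`:
`(∑ ωⱼ Bⱼ⁻¹)⁻¹ ≤ F (B₁, …, Bₙ) ≤ ∑ ωⱼ Bⱼ` for all positive invertible `B₁, …, Bₙ`,
and `F` takes values in the positive invertible operators. -/
def IsAHSandwich {E : Type*} [NormedAddCommGroup E] [InnerProductSpace ℂ E]
    [CompleteSpace E] {n : ℕ} (ω : Fin n → ℝ)
    (F : (Fin n → (E →L[ℂ] E)) → (E →L[ℂ] E)) : Prop :=
  ∀ B : Fin n → (E →L[ℂ] E), (∀ j, 0 ≤ B j) → (∀ j, IsUnit (B j)) →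
    (0 ≤ F B ∧ IsUnit (F B)) ∧
    Ring.inverse (∑ j, ω j • Ring.inverse (B j)) ≤ F B ∧
    F B ≤ ∑ j, ω j • B j

/-- The generalized Kantorovich constant `K(h, p)`, with `K(h, 0) = K(h, 1) = 1`. -/
def Kconst (h p : ℝ) : ℝ :=
  if p = 0 ∨ p = 1 then 1
  else ((h ^ p - h) / ((p - 1) * (h - 1))) *
    (((p - 1) / p) * ((h ^ p - 1) / (h ^ p - h))) ^ p

lemma Ring.inverse_eq_of_mul_eq_one {R : Type*} [MonoidWithZero R] {a b : R} (ha : IsUnit a)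
    (h : a * b = 1) : Ring.inverse a = b := by
  simpa using (Ring.inverse_mul_eq_iff_eq_mul a 1 b ha).2 h.symm

lemma Real.one_add_mul_sub_one_le_rpow {s p : ℝ} (hs : 0 < s) (hp : p ≤ 0 ∨ 1 ≤ p) :
    1 + p * (s - 1) ≤ s ^ p := by
  rcases hp with hp | hp
  · calc 1 + p * (s - 1) ≤ Real.log s * p + 1 := by
          nlinarith [Real.log_le_sub_one_of_pos hs]
      _ ≤ Real.exp (Real.log s * p) := Real.add_one_le_exp _
      _ = s ^ p := (Real.rpow_def_of_pos hs p).symm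
  · simpa using one_add_mul_self_le_rpow_one_add (s := s - 1) (by linarith) hp

/-- On `[1, h]` the function `t ↦ t ^ p` lies below its chord. -/
lemma rpow_le_chord {h p t : ℝ} (hp : p ≤ 0 ∨ 1 ≤ p) (hh : 1 < h) (h1t : 1 ≤ t) (hth : t ≤ h) :
    t ^ p ≤ (h ^ p - 1) / (h - 1) * t + (h - h ^ p) / (h - 1) := by
  have ht : 0 < t := by linarith
  have hh0 : 0 < h := by linarith
  have hpos : 0 < t ^ p := Real.rpow_pos_of_pos ht p
  have tangent : ∀ u, 0 < u → t ^ p * (1 + p * (u / t - 1)) ≤ u ^ p := fun u hu => by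
    have := Real.one_add_mul_sub_one_le_rpow (div_pos hu ht) hp
    rw [Real.div_rpow hu.le ht.le, le_div_iff₀ hpos] at this
    linarith
  have left := mul_le_mul_of_nonneg_left (tangent 1 one_pos) (sub_nonneg.2 hth)
  have right := mul_le_mul_of_nonneg_left (tangent h hh0) (sub_nonneg.2 h1t)
  have key : (h - t) * (t ^ p * (1 + p * (1 / t - 1))) + (t - 1) * (t ^ p * (1 + p * (h / t - 1)))
      = t ^ p * (h - 1) := by
    field_simp
    ring
  rw [div_mul_eq_mul_div, ← add_div, le_div_iff₀ (by linarith)]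
  rw [Real.one_rpow] at left
  linarith

/-- The line through `(1, 1)` and `(h, h ^ p)` lies below `K(h, p) t ^ p`. -/
lemma chord_le_Kconst_mul_rpow {h p t : ℝ} (hp : p < 0 ∨ 1 < p) (hh : 1 < h) (ht : 0 < t) :
    (h ^ p - 1) / (h - 1) * t + (h - h ^ p) / (h - 1) ≤ Kconst h p * t ^ p := by
  have hh1 : 0 < h - 1 := by linarith
  have hp0 : p ≠ 0 := by rcases hp with hp | hp <;> linarith
  have hp1 : p - 1 ≠ 0 := by rcases hp with hp | hp <;> linarith
  obtain ⟨hα, hc, hs⟩ : h ^ p - 1 ≠ 0 ∧ 0 < (h ^ p - h) / ((p - 1) * (h - 1)) ∧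
      0 < (p - 1) / p * ((h ^ p - 1) / (h ^ p - h)) := by
    rcases hp with hp | hp
    · have := Real.rpow_lt_one_of_one_lt_of_neg hh hp
      refine ⟨by linarith, div_pos_of_neg_of_neg (by linarith) ?_, mul_pos ?_ ?_⟩
      · exact mul_neg_of_neg_of_pos (by linarith) hh1
      · exact div_pos_of_neg_of_neg (by linarith) hp
      · exact div_pos_of_neg_of_neg (by linarith) (by linarith)
    · have : h ^ (1 : ℝ) < h ^ p := Real.rpow_lt_rpow_of_exponent_lt hh hp
      rw [Real.rpow_one] at this
      refine ⟨by linarith, div_pos (by linarith) ?_, mul_pos ?_ ?_⟩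
      · exact mul_pos (by linarith) hh1
      · exact div_pos (by linarith) (by linarith)
      · exact div_pos (by linarith) (by linarith)
  have hβ : h ^ p - h ≠ 0 := fun h0 => by simp [h0] at hc
  rw [Kconst, if_neg (by rintro (h0 | h0) <;> [exact hp0 h0; exact hp1 (by linarith)]), mul_assoc,
    ← Real.mul_rpow hs.le ht.le]
  refine le_trans (le_of_eq ?_) (mul_le_mul_of_nonneg_left
    (Real.one_add_mul_sub_one_le_rpow (mul_pos hs ht) (hp.imp le_of_lt le_of_lt)) hc.le)
  field_simp
  ring

/-- An affine function lying above `t ^ p` on `[m, M]` and below `K(M / m, p) t ^ p` on `(0, ∞)`. -/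
lemma exists_affine_between_rpow {m M p : ℝ} (hp : p < 0 ∨ 1 ≤ p) (hm : 0 < m) (hmM : m < M) :
    ∃ a b : ℝ, (1 ≤ p → 0 ≤ a) ∧ (∀ t, m ≤ t → t ≤ M → t ^ p ≤ a * t + b) ∧
      ∀ t, 0 < t → a * t + b ≤ Kconst (M / m) p * t ^ p := by
  by_cases hp1 : p = 1
  · subst hp1
    exact ⟨1, 0, by simp, by simp, by simp [Kconst]⟩
  have hp' : p < 0 ∨ 1 < p := hp.imp_right fun h => lt_of_le_of_ne h (Ne.symm hp1)
  set h := M / m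
  have hh : 1 < h := (one_lt_div hm).2 hmM
  have hmp : 0 < m ^ p := Real.rpow_pos_of_pos hm p
  have rescale : ∀ t, m ^ p * ((h ^ p - 1) / (h - 1)) / m * t + m ^ p * ((h - h ^ p) / (h - 1)) =
      m ^ p * ((h ^ p - 1) / (h - 1) * (t / m) + (h - h ^ p) / (h - 1)) := fun t => by ring
  have rpow_eq : ∀ t, 0 < t → t ^ p = m ^ p * (t / m) ^ p := fun t ht => by
    rw [Real.div_rpow ht.le hm.le, mul_div_cancel₀ _ hmp.ne']
  refine ⟨m ^ p * ((h ^ p - 1) / (h - 1)) / m, m ^ p * ((h - h ^ p) / (h - 1)), fun hp => ?_,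
    fun t hmt htM => ?_, fun t ht => ?_⟩
  · have := Real.one_le_rpow hh.le (by linarith : 0 ≤ p)
    have : 0 ≤ (h ^ p - 1) / (h - 1) := div_nonneg (by linarith) (by linarith)
    positivity
  · rw [rescale, rpow_eq t (by linarith)]
    exact mul_le_mul_of_nonneg_left (rpow_le_chord (hp.imp_left le_of_lt) hh
      ((one_le_div hm).2 hmt) (div_le_div_of_nonneg_right htM hm.le)) hmp.le
  · rw [rescale, rpow_eq t ht, mul_left_comm]
    exact mul_le_mul_of_nonneg_left (chord_le_Kconst_mul_rpow hp' hh (div_pos ht hm)) hmp.le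

lemma Kconst_pos {m M p : ℝ} (hp : p < 0 ∨ 1 ≤ p) (hm : 0 < m) (hmM : m < M) :
    0 < Kconst (M / m) p := by
  obtain ⟨a, b, -, h1, h2⟩ := exists_affine_between_rpow hp hm hmM
  have hmp : 0 < m ^ p := Real.rpow_pos_of_pos hm p
  exact pos_of_mul_pos_left (hmp.trans_le ((h1 m le_rfl hmM.le).trans (h2 m hm))) hmp.le

lemma cfc_affine {𝓐 : Type*} [CStarAlgebra 𝓐] {X : 𝓐} (hX : IsSelfAdjoint X) (a b : ℝ) :
    cfc (fun t : ℝ => a * t + b) X = a • X + b • (1 : 𝓐) := by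
  rw [cfc_add_const b (fun t : ℝ => a * t) X, cfc_const_mul_id a X, Algebra.algebraMap_eq_smul_one]

section CStarAlgebra

variable {𝓐 : Type*} [CStarAlgebra 𝓐] [PartialOrder 𝓐] [StarOrderedRing 𝓐]

lemma isStrictlyPositive_of_smul_one_le {m : ℝ} (hm : 0 < m) {X : 𝓐} (hX : m • (1 : 𝓐) ≤ X) :
    IsStrictlyPositive X := by
  have : IsStrictlyPositive (m • (1 : 𝓐)) := IsStrictlyPositive.smul hm isStrictlyPositive_one
  exact this.of_le hX

lemma continuousOn_rpow_spectrum {X : 𝓐} (hX : IsStrictlyPositive X) (p : ℝ) :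
    ContinuousOn (fun t : ℝ => t ^ p) (spectrum ℝ X) := fun t ht =>
  (Real.continuousAt_rpow_const t p (Or.inl (hX.spectrum_pos ht).ne')).continuousWithinAt

lemma CFC.rpow_le_affine {m M p a b : ℝ} (hm : 0 < m) {X : 𝓐} (h1 : m • (1 : 𝓐) ≤ X)
    (h2 : X ≤ M • (1 : 𝓐)) (h : ∀ t, m ≤ t → t ≤ M → t ^ p ≤ a * t + b) :
    X ^ p ≤ a • X + b • (1 : 𝓐) := by
  have hX := isStrictlyPositive_of_smul_one_le hm h1
  have hsa : IsSelfAdjoint X := hX.isSelfAdjoint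
  rw [← Algebra.algebraMap_eq_smul_one] at h1 h2
  rw [CFC.rpow_eq_cfc_real hX.nonneg, ← cfc_affine hsa]
  have hc := continuousOn_rpow_spectrum hX p
  exact cfc_mono fun t ht => h t ((algebraMap_le_iff_le_spectrum hsa).1 h1 t ht)
    ((le_algebraMap_iff_spectrum_le hsa).1 h2 t ht)

lemma CFC.affine_le_smul_rpow {p a b K : ℝ} {X : 𝓐} (hX : IsStrictlyPositive X)
    (h : ∀ t, 0 < t → a * t + b ≤ K * t ^ p) :
    a • X + b • (1 : 𝓐) ≤ K • X ^ p := by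
  have hc := continuousOn_rpow_spectrum hX p
  rw [CFC.rpow_eq_cfc_real hX.nonneg, ← cfc_affine hX.isSelfAdjoint, ← cfc_const_mul K _ X]
  exact cfc_mono fun t ht => h t (hX.spectrum_pos ht)

lemma smul_one_le_sum {n : ℕ} {ω : Fin n → ℝ} (hω0 : ∀ j, 0 ≤ ω j) (hω1 : ∑ j, ω j = 1)
    {m : ℝ} {X : Fin n → 𝓐} (h : ∀ j, m • (1 : 𝓐) ≤ X j) : m • (1 : 𝓐) ≤ ∑ j, ω j • X j :=
  calc m • (1 : 𝓐) = ∑ j, ω j • m • (1 : 𝓐) := by rw [← Finset.sum_smul, hω1, one_smul]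
    _ ≤ _ := Finset.sum_le_sum fun j _ => smul_le_smul_of_nonneg_left (h j) (hω0 j)

lemma sum_le_smul_one {n : ℕ} {ω : Fin n → ℝ} (hω0 : ∀ j, 0 ≤ ω j) (hω1 : ∑ j, ω j = 1)
    {M : ℝ} {X : Fin n → 𝓐} (h : ∀ j, X j ≤ M • (1 : 𝓐)) : ∑ j, ω j • X j ≤ M • (1 : 𝓐) :=
  calc _ ≤ ∑ j, ω j • M • (1 : 𝓐) :=
        Finset.sum_le_sum fun j _ => smul_le_smul_of_nonneg_left (h j) (hω0 j)
    _ = M • (1 : 𝓐) := by rw [← Finset.sum_smul, hω1, one_smul]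

lemma isStrictlyPositive_sum_smul {n : ℕ} {ω : Fin n → ℝ} (hω0 : ∀ j, 0 ≤ ω j)
    (hω1 : ∑ j, ω j = 1) {X : Fin n → 𝓐} (hX : ∀ j, IsStrictlyPositive (X j)) :
    IsStrictlyPositive (∑ j, ω j • X j) := by
  obtain ⟨i, -, hi⟩ : ∃ i ∈ Finset.univ, 0 < ω i :=
    (Finset.sum_pos_iff_of_nonneg fun j _ => hω0 j).1 (by rw [hω1]; exact one_pos)
  exact (IsStrictlyPositive.smul hi (hX i)).of_le (Finset.single_le_sum
    (f := fun j => ω j • X j) (fun j _ => smul_nonneg (hω0 j) (hX j).nonneg) (Finset.mem_univ i))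

/-- The reverse Jensen inequality for the power function. -/
lemma sum_rpow_le_Kconst_smul_rpow_sum {n : ℕ} {ω : Fin n → ℝ} (hω0 : ∀ j, 0 ≤ ω j)
    (hω1 : ∑ j, ω j = 1) {m M p : ℝ} (hp : p < 0 ∨ 1 ≤ p) (hm : 0 < m) (hmM : m < M)
    {X : Fin n → 𝓐} (h1 : ∀ j, m • (1 : 𝓐) ≤ X j) (h2 : ∀ j, X j ≤ M • (1 : 𝓐)) :
    ∑ j, ω j • X j ^ p ≤ Kconst (M / m) p • (∑ j, ω j • X j) ^ p := by
  obtain ⟨a, b, -, hab, habK⟩ := exists_affine_between_rpow hp hm hmM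
  calc ∑ j, ω j • X j ^ p ≤ ∑ j, ω j • (a • X j + b • (1 : 𝓐)) :=
        Finset.sum_le_sum fun j _ =>
          smul_le_smul_of_nonneg_left (CFC.rpow_le_affine hm (h1 j) (h2 j) hab) (hω0 j)
    _ = a • (∑ j, ω j • X j) + b • (1 : 𝓐) := by
        simp only [smul_add, Finset.sum_add_distrib, Finset.smul_sum, smul_comm a]
        rw [← Finset.sum_smul, hω1, one_smul]
    _ ≤ _ := CFC.affine_le_smul_rpow
        (isStrictlyPositive_of_smul_one_le hm (smul_one_le_sum hω0 hω1 h1)) habK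

/-- The Kantorovich substitute for the monotonicity of `t ↦ t ^ p` when `1 ≤ p`, with the spectral
bounds on the smaller operator. -/
lemma rpow_le_Kconst_smul_rpow_of_le_left {m M p : ℝ} (hp : 1 ≤ p) (hm : 0 < m) (hmM : m < M)
    {X Y : 𝓐} (h1 : m • (1 : 𝓐) ≤ X) (h2 : X ≤ M • (1 : 𝓐)) (hXY : X ≤ Y) :
    X ^ p ≤ Kconst (M / m) p • Y ^ p := by
  obtain ⟨a, b, ha, hab, habK⟩ := exists_affine_between_rpow (Or.inr hp) hm hmM
  calc X ^ p ≤ a • X + b • (1 : 𝓐) := CFC.rpow_le_affine hm h1 h2 hab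
    _ ≤ a • Y + b • (1 : 𝓐) :=
        add_le_add_left (smul_le_smul_of_nonneg_left hXY (ha hp)) _
    _ ≤ _ := CFC.affine_le_smul_rpow (isStrictlyPositive_of_smul_one_le hm (h1.trans hXY)) habK

lemma ringInverse_smul_one {m : ℝ} (hm : 0 < m) : Ring.inverse (m • (1 : 𝓐)) = m⁻¹ • (1 : 𝓐) :=
  Ring.inverse_eq_of_mul_eq_one (isStrictlyPositive_of_smul_one_le hm le_rfl).isUnit
    (by simp [smul_smul, hm.ne'])

lemma ringInverse_le_of_smul_one_le {m : ℝ} (hm : 0 < m) {X : 𝓐} (h : m • (1 : 𝓐) ≤ X) :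
    Ring.inverse X ≤ m⁻¹ • (1 : 𝓐) := by
  rw [← ringInverse_smul_one hm]
  exact CStarAlgebra.antitoneOn_ringInverse (isStrictlyPositive_of_smul_one_le hm le_rfl)
    (isStrictlyPositive_of_smul_one_le hm h) h

lemma smul_one_le_ringInverse {M : ℝ} (hM : 0 < M) {X : 𝓐} (hX : IsStrictlyPositive X)
    (h : X ≤ M • (1 : 𝓐)) : M⁻¹ • (1 : 𝓐) ≤ Ring.inverse X := by
  rw [← ringInverse_smul_one hM]
  exact CStarAlgebra.antitoneOn_ringInverse hX (isStrictlyPositive_of_smul_one_le hM le_rfl) h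

lemma CFC.ringInverse_rpow_neg {X : 𝓐} (hX : IsStrictlyPositive X) {r : ℝ} :
    Ring.inverse X ^ (-r) = X ^ r := by
  rw [CFC.inverse_eq_rpow_neg_one hX, CFC.rpow_rpow X _ _ (by norm_num) hX]
  simp

lemma CFC.ringInverse_rpow {X : 𝓐} (hX : IsStrictlyPositive X) {r : ℝ} :
    Ring.inverse (X ^ r) = X ^ (-r) := by
  exact Ring.inverse_eq_of_mul_eq_one (hX.rpow _ r).isUnit (CFC.rpow_mul_rpow_neg r hX)

lemma CFC.rpow_le_one {X : 𝓐} (hX : 0 ≤ X) (h1 : X ≤ 1) {r : ℝ} (hr : 0 ≤ r) : X ^ r ≤ 1 := by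
  rw [CFC.rpow_eq_cfc_real hX]
  refine cfc_le_one _ _ fun t ht => Real.rpow_le_one (spectrum_nonneg_of_nonneg hX ht) ?_ hr
  rw [← map_one (algebraMap ℝ 𝓐)] at h1
  exact (le_algebraMap_iff_spectrum_le (IsSelfAdjoint.of_nonneg hX)).1 h1 t ht

end CStarAlgebra

theorem stmt14
    {H : Type*}
    [NormedAddCommGroup H] [InnerProductSpace ℂ H] [CompleteSpace H]
    {n : ℕ} (ω : Fin n → ℝ) (hω0 : ∀ j, 0 ≤ ω j) (hω1 : ∑ j, ω j = 1)
    (m M : ℝ) (hm : 0 < m) (hmM : m < M)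
    (A : Fin n → (H →L[ℂ] H))
    (hA0 : ∀ j, 0 ≤ A j) (hAu : ∀ j, IsUnit (A j))
    (hA1 : ∀ j, m • (1 : H →L[ℂ] H) ≤ A j)
    (hA2 : ∀ j, A j ≤ M • (1 : H →L[ℂ] H))
    (F : (Fin n → (H →L[ℂ] H)) → (H →L[ℂ] H))
    (hF : IsAHSandwich ω F)
    (r : ℝ) (hr : 1 ≤ r)
    :
    (((Kconst (M / m) (-r))⁻¹ * (Kconst (M / m) r)⁻¹) • CFC.rpow (F A) r ≤
        F (fun j => CFC.rpow (A j) r) ∧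
      F (fun j => CFC.rpow (A j) r) ≤
        (Kconst (M / m) (-r) * Kconst (M / m) r) • CFC.rpow (F A) r) ∧
      (F A ≤ 1 →
        F (fun j => CFC.rpow (A j) r) ≤
          (Kconst (M / m) (-r) * Kconst (M / m) r) • (1 : H →L[ℂ] H)) := by
  have hM : 0 < M := hm.trans hmM
  have hinv : M⁻¹ < m⁻¹ := inv_strictAnti₀ hm hmM
  have hratio : m⁻¹ / M⁻¹ = M / m := by field_simp
  have hneg : -r < 0 ∨ 1 ≤ -r := Or.inl (by linarith)
  have hK : 0 < Kconst (M / m) r := Kconst_pos (Or.inr hr) hm hmM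
  have hK' : 0 < Kconst (M / m) (-r) := Kconst_pos hneg hm hmM
  have hAp : ∀ j, IsStrictlyPositive (A j) := fun j => isStrictlyPositive_of_smul_one_le hm (hA1 j)
  obtain ⟨⟨hF0, -⟩, hHF, hFS⟩ := hF A hA0 hAu
  obtain ⟨-, hHFr, hFSr⟩ := hF (fun j => CFC.rpow (A j) r) (fun j => CFC.rpow_nonneg)
    (fun j => ((hAp j).rpow _ r).isUnit)
  simp only [CFC.rpow_eq_pow] at hHFr hFSr ⊢
  have hI1 := fun j => smul_one_le_ringInverse hM (hAp j) (hA2 j)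
  have hI2 := fun j => ringInverse_le_of_smul_one_le hm (hA1 j)
  have hD1 := smul_one_le_sum hω0 hω1 hI1
  have hD2 := sum_le_smul_one hω0 hω1 hI2
  have hDp := isStrictlyPositive_of_smul_one_le (inv_pos.2 hM) hD1
  have hH1 := smul_one_le_ringInverse (inv_pos.2 hm) hDp hD2
  have hH2 := ringInverse_le_of_smul_one_le (inv_pos.2 hM) hD1
  rw [inv_inv] at hH1 hH2
  have hS1 := smul_one_le_sum hω0 hω1 hA1
  have hS2 := sum_le_smul_one hω0 hω1 hA2
  have hSp := isStrictlyPositive_of_smul_one_le hm hS1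
  have upper : F (fun j => A j ^ r) ≤ (Kconst (M / m) (-r) * Kconst (M / m) r) • F A ^ r := by
    have hJ := sum_rpow_le_Kconst_smul_rpow_sum hω0 hω1 hneg (inv_pos.2 hM) hinv hI1 hI2
    simp only [CFC.ringInverse_rpow_neg (hAp _), hratio] at hJ
    have hinvD : (∑ j, ω j • Ring.inverse (A j)) ^ (-r) =
        Ring.inverse (∑ j, ω j • Ring.inverse (A j)) ^ r := by
      rw [← CFC.ringInverse_rpow_neg hDp.ringInverse, Ring.inverse_inverse hDp.isUnit]
    rw [hinvD] at hJ
    rw [mul_smul]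
    exact (hFSr.trans hJ).trans (smul_le_smul_of_nonneg_left
      (rpow_le_Kconst_smul_rpow_of_le_left hr hm hmM hH1 hH2 hHF) hK'.le)
  refine ⟨⟨?_, upper⟩, fun hF1 => upper.trans
    (smul_le_smul_of_nonneg_left (CFC.rpow_le_one hF0 hF1 (by linarith)) (by positivity))⟩
  have hJ := sum_rpow_le_Kconst_smul_rpow_sum hω0 hω1 hneg hm hmM hA1 hA2
  have hFr : F A ^ r ≤ Kconst (M / m) r • (∑ j, ω j • A j) ^ r :=
    rpow_le_Kconst_smul_rpow_of_le_left hr hm hmM (hH1.trans hHF) (hFS.trans hS2) hFS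
  have hinvS : Ring.inverse (Kconst (M / m) (-r) • (∑ j, ω j • A j) ^ (-r)) =
      (Kconst (M / m) (-r))⁻¹ • (∑ j, ω j • A j) ^ r :=
    Ring.inverse_eq_of_mul_eq_one (IsStrictlyPositive.smul hK' (hSp.rpow _ _)).isUnit
      (by rw [smul_mul_smul_comm, mul_inv_cancel₀ hK'.ne', CFC.rpow_neg_mul_rpow r hSp, one_smul])
  simp only [CFC.ringInverse_rpow (hAp _)] at hHFr
  calc ((Kconst (M / m) (-r))⁻¹ * (Kconst (M / m) r)⁻¹) • F A ^ r
      ≤ ((Kconst (M / m) (-r))⁻¹ * (Kconst (M / m) r)⁻¹) •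
          Kconst (M / m) r • (∑ j, ω j • A j) ^ r :=
        smul_le_smul_of_nonneg_left hFr (by positivity)
    _ = Ring.inverse (Kconst (M / m) (-r) • (∑ j, ω j • A j) ^ (-r)) := by
        rw [hinvS, smul_smul, inv_mul_cancel_right₀ hK.ne']
    _ ≤ Ring.inverse (∑ j, ω j • A j ^ (-r)) :=
        CStarAlgebra.ringInverse_le_ringInverse hJ
          (isStrictlyPositive_sum_smul hω0 hω1 fun j => (hAp j).rpow _ _)
    _ ≤ _ := hHFr
end
end

section
/- Let A₁, …, Aₙ be positive invertible operators on H with mI ≤ Aⱼ ≤ MI (j = 1, …, n) for some scalars 0 < m < M, let h = M/m, and let F satisfy the arithmetic–harmonic sandwich for the probability vector ω. Then for all real p, q with 1 ≤ q ≤ p, K(hᵖ, −q/p)^{−1/q}·F(A₁ᵖ, …, Aₙᵖ)^{1/p} ≤ F(A₁^q, …, Aₙ^q)^{1/q} ≤ K(hᵖ, −q/p)^{1/q}·F(A₁ᵖ, …, Aₙᵖ)^{1/p}. -/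
noncomputable section

lemma Kconst_neg_eq {h r : ℝ} (hh : 1 < h) (hr : 0 < r) :
    Kconst h (-r) = (h - h ^ (-r)) / ((1 + r) * (h - 1)) *
      (r / (1 + r) * ((h - h ^ (-r)) / (1 - h ^ (-r)))) ^ r := by
  have h1 : h ^ (-r) < 1 := Real.rpow_lt_one_of_one_lt_of_neg hh (by linarith)
  have hbase : (-r - 1) / (-r) * ((h ^ (-r) - 1) / (h ^ (-r) - h)) =
      (r / (1 + r) * ((h - h ^ (-r)) / (1 - h ^ (-r))))⁻¹ := by
    have e1 : h ^ (-r) - 1 ≠ 0 := by linarith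
    have e2 : h ^ (-r) - h ≠ 0 := by linarith
    have e3 : 1 - h ^ (-r) ≠ 0 := by linarith
    have e4 : h - h ^ (-r) ≠ 0 := by linarith
    have e5 : 1 + r ≠ 0 := by linarith
    field_simp
    ring
  have hpos : 0 < r / (1 + r) * ((h - h ^ (-r)) / (1 - h ^ (-r))) :=
    mul_pos (by positivity) (div_pos (by linarith) (by linarith))
  rw [Kconst, if_neg (by rintro (h0 | h0) <;> linarith), hbase, Real.inv_rpow hpos.le,
    Real.rpow_neg hpos.le, inv_inv]
  congr 1
  rw [← neg_div_neg_eq]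
  congr 1 <;> ring

lemma rpow_neg_le_chord {h r x : ℝ} (hh : 1 < h) (hr0 : 0 < r) (hr1 : r ≤ 1)
    (hx : x ∈ Set.Icc 1 h) :
    x ^ (-r) ≤ (h - h ^ (-r)) / (h - 1) - (1 - h ^ (-r)) / (h - 1) * x := by
  obtain ⟨hx1, hx2⟩ := hx
  have hh0 : 0 < h := by linarith
  have hx0 : 0 < x := by linarith
  have hd : 0 < h - 1 := by linarith
  set s := (h - x) / (h - 1) with hs
  set t := (x - 1) / (h - 1) with ht
  have hs0 : 0 ≤ s := div_nonneg (by linarith) hd.le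
  have ht0 : 0 ≤ t := div_nonneg (by linarith) hd.le
  have hst : s + t = 1 := by rw [hs, ht]; field_simp; ring
  have hxe : s * 1 + t * h = x := by rw [hs, ht]; field_simp; ring
  have hconc := (Real.concaveOn_rpow hr0.le hr1).2 (x := 1) (y := h) (by simp)
    (by simpa using hh0.le) hs0 ht0 hst
  have hconv := (convexOn_zpow (𝕜 := ℝ) (-1)).2 (x := 1) (y := h ^ r) (by simp)
    (by simpa using Real.rpow_pos_of_pos hh0 r) hs0 ht0 hst
  simp only [smul_eq_mul, hxe, Real.one_rpow, zpow_neg_one, inv_one] at hconc hconv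
  have hpos : 0 < s * 1 + t * h ^ r := by
    have := Real.one_le_rpow hh.le hr0.le
    nlinarith
  calc x ^ (-r) = (x ^ r)⁻¹ := Real.rpow_neg hx0.le r
    _ ≤ (s * 1 + t * h ^ r)⁻¹ := inv_anti₀ hpos hconc
    _ ≤ s * 1 + t * (h ^ r)⁻¹ := hconv
    _ = _ := by
      rw [← Real.rpow_neg hh0.le, hs, ht]
      field_simp
      ring

lemma chord_le_Kconst_mul_rpow_neg {h r x : ℝ} (hh : 1 < h) (hr : 0 < r) (hx : 0 < x) :
    (h - h ^ (-r)) / (h - 1) - (1 - h ^ (-r)) / (h - 1) * x ≤ Kconst h (-r) * x ^ (-r) := by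
  have h1 : h ^ (-r) < 1 := Real.rpow_lt_one_of_one_lt_of_neg hh (by linarith)
  have hd : 0 < h - 1 := by linarith
  have e3 : 0 < 1 - h ^ (-r) := by linarith
  have e4 : 0 < h - h ^ (-r) := by linarith
  rw [Kconst_neg_eq hh hr]
  set t := r / (1 + r) * ((h - h ^ (-r)) / (1 - h ^ (-r))) with ht
  have ht0 : 0 < t := by positivity
  have hbern : 1 - r * (x / t - 1) ≤ (t / x) ^ r := by
    have hlog : Real.log (x / t) ≤ x / t - 1 := Real.log_le_sub_one_of_pos (by positivity)
    have hexp := Real.add_one_le_exp (Real.log (t / x) * r)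
    rw [← Real.rpow_def_of_pos (by positivity)] at hexp
    have hinv : Real.log (t / x) = -Real.log (x / t) := by
      rw [← Real.log_inv, inv_div]
    rw [hinv] at hexp
    nlinarith
  calc (h - h ^ (-r)) / (h - 1) - (1 - h ^ (-r)) / (h - 1) * x
      = (h - h ^ (-r)) / ((1 + r) * (h - 1)) * (1 - r * (x / t - 1)) := by
        rw [ht]
        field_simp
        ring
    _ ≤ (h - h ^ (-r)) / ((1 + r) * (h - 1)) * (t / x) ^ r := by gcongr
    _ = _ := by
        rw [Real.div_rpow ht0.le hx.le, Real.rpow_neg hx.le]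
        ring

lemma one_le_Kconst_neg {h r : ℝ} (hh : 1 < h) (hr : 0 < r) : 1 ≤ Kconst h (-r) := by
  have hd : h - 1 ≠ 0 := by linarith
  have h1 := chord_le_Kconst_mul_rpow_neg hh hr one_pos
  rw [Real.one_rpow, mul_one, mul_one, ← sub_div, sub_sub_sub_cancel_right, div_self hd] at h1
  exact h1

/-- On `[a, h a]` the convex function `x ↦ x ^ (-r)` lies below an affine function which in turn
lies below `Kconst h (-r)` times the function on the whole half line. -/
lemma exists_affine_between_rpow_neg {a h r : ℝ} (ha : 0 < a) (hh : 1 < h) (hr0 : 0 < r)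
    (hr1 : r ≤ 1) :
    ∃ α β : ℝ, (∀ x ∈ Set.Icc a (h * a), x ^ (-r) ≤ α * x + β) ∧
      ∀ x, 0 < x → α * x + β ≤ Kconst h (-r) * x ^ (-r) := by
  have hscale : ∀ x : ℝ, 0 < x → a ^ (-r) * (x / a) ^ (-r) = x ^ (-r) := fun x hx => by
    rw [← Real.mul_rpow ha.le (by positivity), mul_div_cancel₀ _ ha.ne']
  have hapos := Real.rpow_pos_of_pos ha (-r)
  refine ⟨-(a ^ (-r) * ((1 - h ^ (-r)) / (h - 1)) / a), a ^ (-r) * ((h - h ^ (-r)) / (h - 1)),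
    fun x hx => ?_, fun x hx => ?_⟩
  · rw [← hscale x (ha.trans_le hx.1)]
    refine (mul_le_mul_of_nonneg_left (rpow_neg_le_chord hh hr0 hr1 (x := x / a)
      ⟨(one_le_div ha).2 hx.1, (div_le_iff₀ ha).2 hx.2⟩) hapos.le).trans_eq ?_
    ring
  · rw [← hscale x hx, mul_left_comm]
    refine le_trans (le_of_eq ?_) (mul_le_mul_of_nonneg_left
      (chord_le_Kconst_mul_rpow_neg hh hr0 (x := x / a) (by positivity)) hapos.le)
    ring

section CStarAlgebra

lemma cfc_affine_eq {A : Type*} [CStarAlgebra A] {a : A} (ha : IsSelfAdjoint a) (α β : ℝ) :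
    cfc (fun x : ℝ => α * x + β) a = α • a + algebraMap ℝ A β := by
  rw [cfc_add_const β _ a, cfc_const_mul_id α a]

variable {A : Type*} [CStarAlgebra A] [PartialOrder A] [StarOrderedRing A]

lemma continuousOn_rpow_spectrum_s17 {a : A} (ha : IsStrictlyPositive a) (y : ℝ) :
    ContinuousOn (fun x : ℝ => x ^ y) (spectrum ℝ a) := fun x hx =>
  (Real.continuousAt_rpow_const x y (.inl (ha.spectrum_pos hx).ne')).continuousWithinAt

lemma cfc_rpow_smul {a : A} (ha : IsStrictlyPositive a) {c : ℝ} (hc : 0 < c) (y : ℝ) :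
    (c • a) ^ y = c ^ y • a ^ y := by
  rw [← cfc_const_mul_id c a ha.isSelfAdjoint,
    CFC.cfc_rpow (fun x hx => mul_pos hc (ha.spectrum_pos hx)) (by fun_prop) ha.isSelfAdjoint,
    CFC.rpow_eq_cfc_real ha.nonneg, ← cfc_smul _ _ _ (continuousOn_rpow_spectrum_s17 ha y)]
  exact cfc_congr fun x hx => Real.mul_rpow hc.le (ha.spectrum_pos hx).le

lemma cfc_rpow_mem_Icc {a : A} {m M y : ℝ} (hm : 0 < m) (hy : 0 ≤ y)
    (h1 : algebraMap ℝ A m ≤ a) (h2 : a ≤ algebraMap ℝ A M) :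
    algebraMap ℝ A (m ^ y) ≤ a ^ y ∧ a ^ y ≤ algebraMap ℝ A (M ^ y) := by
  have ha : IsStrictlyPositive a := (isStrictlyPositive_algebraMap hm).of_le h1
  have hcont := continuousOn_rpow_spectrum_s17 ha y
  have hsa := ha.isSelfAdjoint
  rw [algebraMap_le_iff_le_spectrum] at h1
  rw [le_algebraMap_iff_spectrum_le] at h2
  rw [CFC.rpow_eq_cfc_real ha.nonneg]
  exact ⟨algebraMap_le_cfc _ _ _ fun x hx => Real.rpow_le_rpow hm.le (h1 x hx) hy,
    cfc_le_algebraMap _ _ _ fun x hx => Real.rpow_le_rpow (ha.spectrum_pos hx).le (h2 x hx) hy⟩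

lemma cfc_rpow_mem_Icc_of_nonpos {a : A} {m M y : ℝ} (hm : 0 < m)
    (hy : y ≤ 0) (h1 : algebraMap ℝ A m ≤ a) (h2 : a ≤ algebraMap ℝ A M) :
    algebraMap ℝ A (M ^ y) ≤ a ^ y ∧ a ^ y ≤ algebraMap ℝ A (m ^ y) := by
  have ha : IsStrictlyPositive a := (isStrictlyPositive_algebraMap hm).of_le h1
  have hcont := continuousOn_rpow_spectrum_s17 ha y
  have hsa := ha.isSelfAdjoint
  rw [algebraMap_le_iff_le_spectrum] at h1
  rw [le_algebraMap_iff_spectrum_le] at h2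
  rw [CFC.rpow_eq_cfc_real ha.nonneg]
  exact ⟨algebraMap_le_cfc _ _ _ fun x hx =>
      Real.rpow_le_rpow_of_nonpos (ha.spectrum_pos hx) (h2 x hx) hy,
    cfc_le_algebraMap _ _ _ fun x hx => Real.rpow_le_rpow_of_nonpos hm (h1 x hx) hy⟩

lemma isStrictlyPositive_sum_smul_s17 {ι : Type*} [Fintype ι] {ω : ι → ℝ} (hω0 : ∀ j, 0 ≤ ω j)
    (hω1 : ∑ j, ω j = 1) {C : ι → A} (hC : ∀ j, IsStrictlyPositive (C j)) :
    IsStrictlyPositive (∑ j, ω j • C j) := by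
  classical
  obtain ⟨i, -, hi⟩ := Finset.exists_ne_zero_of_sum_ne_zero (hω1.trans_ne one_ne_zero)
  rw [← Finset.add_sum_erase _ _ (Finset.mem_univ i)]
  exact ((hC i).smul ((hω0 i).lt_of_ne' hi)).add_nonneg
    (Finset.sum_nonneg fun j _ => smul_nonneg (hω0 j) (hC j).nonneg)

/-- The Mond–Pečarić converse of Jensen's inequality for `x ↦ x ^ (-r)`. -/
lemma sum_rpow_neg_le_Kconst_smul {ι : Type*} [Fintype ι] {ω : ι → ℝ} (hω0 : ∀ j, 0 ≤ ω j)
    (hω1 : ∑ j, ω j = 1) {a h r : ℝ} (ha : 0 < a) (hh : 1 < h) (hr0 : 0 < r) (hr1 : r ≤ 1)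
    {C : ι → A} (hC : ∀ j, IsStrictlyPositive (C j))
    (hCa : ∀ j, algebraMap ℝ A a ≤ C j) (hCb : ∀ j, C j ≤ algebraMap ℝ A (h * a)) :
    ∑ j, ω j • C j ^ (-r) ≤ Kconst h (-r) • (∑ j, ω j • C j) ^ (-r) := by
  have hconst : ∀ c : ℝ, ∑ j, ω j • algebraMap ℝ A c = algebraMap ℝ A c := fun c => by
    rw [← Finset.sum_smul, hω1, one_smul]
  have hS := isStrictlyPositive_sum_smul_s17 hω0 hω1 hC
  obtain ⟨α, β, h1, h2⟩ := exists_affine_between_rpow_neg ha hh hr0 hr1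
  calc ∑ j, ω j • C j ^ (-r) ≤ ∑ j, ω j • (α • C j + algebraMap ℝ A β) := by
        refine Finset.sum_le_sum fun j _ => smul_le_smul_of_nonneg_left ?_ (hω0 j)
        rw [← cfc_affine_eq (hC j).isSelfAdjoint, CFC.rpow_eq_cfc_real (hC j).nonneg]
        refine cfc_mono (fun x hx => h1 x ⟨?_, ?_⟩) (continuousOn_rpow_spectrum_s17 (hC j) _)
        · exact (algebraMap_le_iff_le_spectrum (hC j).isSelfAdjoint).1 (hCa j) x hx
        · exact (le_algebraMap_iff_spectrum_le (hC j).isSelfAdjoint).1 (hCb j) x hx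
    _ = α • ∑ j, ω j • C j + algebraMap ℝ A β := by
        simp only [smul_add, Finset.sum_add_distrib, hconst, Finset.smul_sum, smul_comm α]
    _ ≤ Kconst h (-r) • (∑ j, ω j • C j) ^ (-r) := by
        rw [← cfc_affine_eq hS.isSelfAdjoint, CFC.rpow_eq_cfc_real hS.nonneg,
          ← cfc_smul _ _ _ (continuousOn_rpow_spectrum_s17 hS _)]
        exact cfc_mono (fun x hx => h2 x (hS.spectrum_pos hx))
          (by fun_prop) (continuousOn_const.mul (continuousOn_rpow_spectrum_s17 hS _))

/-- The two-sided estimate for a pair of values `X`, `Y` squeezed between the weighted harmonic and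
arithmetic means of the `p`-th, respectively `q`-th, powers of a tuple. -/
lemma Kconst_rpow_smul_le_and_le {ι : Type*} [Fintype ι] {ω : ι → ℝ} (hω0 : ∀ j, 0 ≤ ω j)
    (hω1 : ∑ j, ω j = 1) {m M : ℝ} (hm : 0 < m) (hmM : m < M) {B : ι → A}
    (hB : ∀ j, IsStrictlyPositive (B j)) (hB1 : ∀ j, algebraMap ℝ A m ≤ B j)
    (hB2 : ∀ j, B j ≤ algebraMap ℝ A M) {p q : ℝ} (hq : 1 ≤ q) (hqp : q ≤ p) {X Y : A}
    (hX : IsStrictlyPositive X)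
    (hX1 : Ring.inverse (∑ j, ω j • Ring.inverse (B j ^ p)) ≤ X) (hX2 : X ≤ ∑ j, ω j • B j ^ p)
    (hY1 : Ring.inverse (∑ j, ω j • Ring.inverse (B j ^ q)) ≤ Y) (hY2 : Y ≤ ∑ j, ω j • B j ^ q) :
    Kconst ((M / m) ^ p) (-(q / p)) ^ (-(1 / q)) • X ^ (1 / p) ≤ Y ^ (1 / q) ∧
      Y ^ (1 / q) ≤ Kconst ((M / m) ^ p) (-(q / p)) ^ (1 / q) • X ^ (1 / p) := by
  have hM : 0 < M := hm.trans hmM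
  have hq0 : 0 < q := by linarith
  have hp0 : 0 < p := by linarith
  have hr0 : 0 < q / p := by positivity
  have hr1 : q / p ≤ 1 := (div_le_one hp0).2 hqp
  have hq1 : 1 / q ∈ Set.Icc (0 : ℝ) 1 := ⟨by positivity, (div_le_one hq0).2 hq⟩
  have hh : 1 < (M / m) ^ p := Real.one_lt_rpow ((one_lt_div hm).2 hmM) hp0
  have hK : 0 < Kconst ((M / m) ^ p) (-(q / p)) := one_pos.trans_le (one_le_Kconst_neg hh hr0)
  set K := Kconst ((M / m) ^ p) (-(q / p))
  have hinv : ∀ (j) {s : ℝ}, 0 < s → Ring.inverse (B j ^ s) = B j ^ (-s) := fun j s hs => by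
    rw [CFC.inverse_eq_rpow_neg_one ((hB j).rpow _ s), CFC.rpow_rpow _ _ _ hs.ne' (hB j),
      mul_neg_one]
  have hpow : ∀ (s : ℝ), ∀ j, IsStrictlyPositive (B j ^ s) := fun s j => (hB j).rpow _ s
  have hsum : ∀ s : ℝ, IsStrictlyPositive (∑ j, ω j • B j ^ s) := fun s =>
    isStrictlyPositive_sum_smul_s17 hω0 hω1 (hpow s)
  simp only [hinv _ hp0, hinv _ hq0] at hX1 hY1
  rw [CFC.inverse_eq_rpow_neg_one (hsum _)] at hX1 hY1
  have hXr : (X ^ (q / p)) ^ (1 / q) = X ^ (1 / p) := by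
    rw [CFC.rpow_rpow _ _ _ hr0.ne' hX]
    congr 1
    field_simp
  have hXr' := hX.rpow _ (q / p)
  constructor
  · have hT : ∑ j, ω j • B j ^ (-q) ≤ K • (∑ j, ω j • B j ^ p) ^ (-(q / p)) := by
      have key := sum_rpow_neg_le_Kconst_smul hω0 hω1 (Real.rpow_pos_of_pos hm p) hh hr0 hr1
        (hpow p) (fun j => (cfc_rpow_mem_Icc hm hp0.le (hB1 j) (hB2 j)).1)
        (fun j => by
          rw [← Real.mul_rpow (by positivity) hm.le, div_mul_cancel₀ _ hm.ne']
          exact (cfc_rpow_mem_Icc hm hp0.le (hB1 j) (hB2 j)).2)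
      have he : ∀ j, (B j ^ p) ^ (-(q / p)) = B j ^ (-q) := fun j => by
        rw [CFC.rpow_rpow _ _ _ hp0.ne' (hB j)]
        congr 1
        field_simp
      simpa only [he] using key
    have hSX : (∑ j, ω j • B j ^ p) ^ (-(q / p)) ≤ X ^ (-(q / p)) := by
      have h1 := CStarAlgebra.rpow_neg_one_le_rpow_neg_one
        (CFC.rpow_le_rpow ⟨hr0.le, hr1⟩ hX2) hXr'
      rwa [CFC.rpow_rpow _ _ _ hr0.ne' hX, CFC.rpow_rpow _ _ _ hr0.ne' (hsum p),
        mul_neg_one] at h1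
    have hTX : K⁻¹ • X ^ (q / p) ≤ Y := by
      have h1 := CStarAlgebra.rpow_neg_one_le_rpow_neg_one
        (hT.trans (smul_le_smul_of_nonneg_left hSX hK.le)) (hsum (-q))
      rw [cfc_rpow_smul (hX.rpow _ _) hK, CFC.rpow_rpow _ _ _ (neg_ne_zero.2 hr0.ne') hX,
        mul_neg_one, neg_neg, Real.rpow_neg_one] at h1
      exact h1.trans hY1
    have h2 := CFC.rpow_le_rpow hq1 hTX
    rwa [cfc_rpow_smul hXr' (inv_pos.2 hK), hXr, Real.inv_rpow hK.le, ← Real.rpow_neg hK.le] at h2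
  · have hT : ∑ j, ω j • B j ^ q ≤ K • (∑ j, ω j • B j ^ (-p)) ^ (-(q / p)) := by
      have key := sum_rpow_neg_le_Kconst_smul hω0 hω1 (Real.rpow_pos_of_pos hM (-p)) hh hr0 hr1
        (hpow (-p)) (fun j => (cfc_rpow_mem_Icc_of_nonpos hm
          (neg_nonpos.2 hp0.le) (hB1 j) (hB2 j)).1)
        (fun j => by
          have he : (M / m) ^ p * M ^ (-p) = m ^ (-p) := by
            rw [Real.div_rpow hM.le hm.le, Real.rpow_neg hM.le, Real.rpow_neg hm.le]
            field_simp
          rw [he]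
          exact (cfc_rpow_mem_Icc_of_nonpos hm
            (neg_nonpos.2 hp0.le) (hB1 j) (hB2 j)).2)
      have he : ∀ j, (B j ^ (-p)) ^ (-(q / p)) = B j ^ q := fun j => by
        rw [CFC.rpow_rpow _ _ _ (neg_ne_zero.2 hp0.ne') (hB j)]
        congr 1
        field_simp
      simpa only [he] using key
    have hUX : (∑ j, ω j • B j ^ (-p)) ^ (-(q / p)) ≤ X ^ (q / p) := by
      have h1 := CFC.rpow_le_rpow ⟨hr0.le, hr1⟩ hX1
      rwa [CFC.rpow_rpow _ _ _ (by norm_num) (hsum (-p)), neg_one_mul] at h1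
    have h2 := CFC.rpow_le_rpow hq1
      ((hY2.trans hT).trans (smul_le_smul_of_nonneg_left hUX hK.le))
    rwa [cfc_rpow_smul hXr' hK, hXr] at h2

end CStarAlgebra

theorem stmt17
    {H : Type*}
    [NormedAddCommGroup H] [InnerProductSpace ℂ H] [CompleteSpace H]
    {n : ℕ} (ω : Fin n → ℝ) (hω0 : ∀ j, 0 ≤ ω j) (hω1 : ∑ j, ω j = 1)
    (m M : ℝ) (hm : 0 < m) (hmM : m < M)
    (A : Fin n → (H →L[ℂ] H))
    (hA0 : ∀ j, 0 ≤ A j) (hAu : ∀ j, IsUnit (A j))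
    (hA1 : ∀ j, m • (1 : H →L[ℂ] H) ≤ A j)
    (hA2 : ∀ j, A j ≤ M • (1 : H →L[ℂ] H))
    (F : (Fin n → (H →L[ℂ] H)) → (H →L[ℂ] H))
    (hF : IsAHSandwich ω F)
    (p q : ℝ) (hq : 1 ≤ q) (hqp : q ≤ p)
    :
    (Kconst ((M / m) ^ p) (-(q / p))) ^ (-(1 / q)) •
        CFC.rpow (F (fun j => CFC.rpow (A j) p)) (1 / p) ≤
      CFC.rpow (F (fun j => CFC.rpow (A j) q)) (1 / q) ∧
    CFC.rpow (F (fun j => CFC.rpow (A j) q)) (1 / q) ≤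
      (Kconst ((M / m) ^ p) (-(q / p))) ^ (1 / q) •
        CFC.rpow (F (fun j => CFC.rpow (A j) p)) (1 / p) := by
  have hsp : ∀ j, IsStrictlyPositive (A j) := fun j => (hAu j).isStrictlyPositive (hA0 j)
  have hpow : ∀ (s : ℝ) (j), IsStrictlyPositive (A j ^ s) := fun s j => (hsp j).rpow _ s
  obtain ⟨⟨hX0, hXu⟩, hX1, hX2⟩ :=
    hF (fun j => A j ^ p) (fun j => (hpow p j).nonneg) (fun j => (hpow p j).isUnit)
  obtain ⟨-, hY1, hY2⟩ :=
    hF (fun j => A j ^ q) (fun j => (hpow q j).nonneg) (fun j => (hpow q j).isUnit)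
  exact Kconst_rpow_smul_le_and_le hω0 hω1 hm hmM hsp
    (fun j => by simpa only [Algebra.algebraMap_eq_smul_one] using hA1 j)
    (fun j => by simpa only [Algebra.algebraMap_eq_smul_one] using hA2 j) hq hqp
    (hXu.isStrictlyPositive hX0) hX1 hX2 hY1 hY2
end
end
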